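/- arXiv:1107.1963 — 10 statements merged into one kernel-verified Lean document; each statement's English description precedes it below -/
import Mathlib

section
/- Let gt' be the translation from intuitionistic formulas to modal formulas defined by gt'(⊥) = ⊥, gt'(p) = p for every variable p, gt'(α∧β) = gt'(α)∧gt'(β), gt'(α∨β) = gt'(α)∨gt'(β), and gt'(α⇒β) = ◻(gt'(α)→gt'(β)). Then for every intuitionistic formula α, every intuitionistic Kripke model M = (U, ◁, ξ) and every state s ∈ U: M, s ⊨ᵢ α if and only if M, s ⊨ₘ gt'(α). Moreover, if α is an implicational intuitionistic formula (built only from ⊥, variables and ⇒), then gt'(α) is a strictly implicational modal formula (built by the grammar φ ::= ⊥ | p | ◻(φ→φ)). -/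
inductive IForm (α : Type) : Type
  | bot : IForm α
  | var : α → IForm α
  | and : IForm α → IForm α → IForm α
  | or : IForm α → IForm α → IForm α
  | imp : IForm α → IForm α → IForm α

/-- Intuitionistic satisfaction: `M,s ⊨ᵢ φ` over the Kripke model `(U, R, ξ)`. -/
def isat {U α : Type} (R : U → U → Prop) (ξ : α → U → Prop) : U → IForm α → Prop
  | _, .bot => False
  | s, .var p => ξ p s
  | s, .and φ ψ => isat R ξ s φ ∧ isat R ξ s ψ
  | s, .or φ ψ => isat R ξ s φ ∨ isat R ξ s ψ
  | s, .imp φ ψ => ∀ n, R s n → isat R ξ n φ → isat R ξ n ψ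

inductive MForm (α : Type) : Type
  | bot : MForm α
  | var : α → MForm α
  | imp : MForm α → MForm α → MForm α
  | box : MForm α → MForm α

/-- Modal satisfaction: `M,s ⊨ₘ φ` over the Kripke model `(U, R, ξ)`. -/
def msat {U α : Type} (R : U → U → Prop) (ξ : α → U → Prop) : U → MForm α → Prop
  | _, .bot => False
  | s, .var p => ξ p s
  | s, .imp φ ψ => msat R ξ s φ → msat R ξ s ψ
  | s, .box φ => ∀ t, R s t → msat R ξ t φ

def MForm.neg {α : Type} (φ : MForm α) : MForm α := .imp φ .bot
def MForm.top {α : Type} : MForm α := .imp .bot .bot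
def MForm.and {α : Type} (φ ψ : MForm α) : MForm α := .neg (.imp φ (.neg ψ))
def MForm.or {α : Type} (φ ψ : MForm α) : MForm α := .imp (.neg φ) ψ
def MForm.dia {α : Type} (φ : MForm α) : MForm α := .neg (.box (.neg φ))

/-- The translation `gt'` from intuitionistic to modal formulas:
`gt'(⊥)=⊥`, `gt'(p)=p`, it commutes with `∧` and `∨`, and `gt'(α⇒β) = ◻(gt'(α)→gt'(β))`. -/
def gt' {α : Type} : IForm α → MForm α
  | .bot => .bot
  | .var p => .var p
  | .and φ ψ => MForm.and (gt' φ) (gt' ψ)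
  | .or φ ψ => MForm.or (gt' φ) (gt' ψ)
  | .imp φ ψ => .box (.imp (gt' φ) (gt' ψ))

/-- Implicational intuitionistic formulas: built only from `⊥`, variables and `⇒`. -/
inductive IForm.Implicational {α : Type} : IForm α → Prop
  | bot : IForm.Implicational .bot
  | var (p : α) : IForm.Implicational (.var p)
  | imp {φ ψ : IForm α} : φ.Implicational → ψ.Implicational →
      (IForm.imp φ ψ).Implicational

/-- Strictly implicational modal formulas: the grammar `φ ::= ⊥ | p | ◻(φ→φ)`. -/
inductive MForm.StrictImp {α : Type} : MForm α → Prop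
  | bot : MForm.StrictImp .bot
  | var (p : α) : MForm.StrictImp (.var p)
  | boximp {φ ψ : MForm α} : φ.StrictImp → ψ.StrictImp →
      (MForm.box (.imp φ ψ)).StrictImp

/-- Lemma: over any intuitionistic Kripke model (transitive, monotone valuation),
a formula is intuitionistically satisfied at a state iff its `gt'`-translation is
modally satisfied there; and `gt'` maps implicational formulas to strictly
implicational modal formulas. -/
theorem stmt1 {U α : Type} [Fintype U] [Nonempty U]
    (R : U → U → Prop) (ξ : α → U → Prop)
    (htrans : Transitive R)
    (hmono : ∀ (p : α) (s t : U), ξ p s → R s t → ξ p t) :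
    (∀ (φ : IForm α) (s : U), isat R ξ s φ ↔ msat R ξ s (gt' φ)) ∧
    (∀ φ : IForm α, φ.Implicational → (gt' φ).StrictImp) := by
  constructor
  · intro φ
    induction φ with
    | bot => intro s; exact Iff.rfl
    | var p => intro s; exact Iff.rfl
    | and a b iha ihb =>
      intro s
      simp only [isat, gt', MForm.and, MForm.neg, msat, iha, ihb]
      tauto
    | or a b iha ihb =>
      intro s
      simp only [isat, gt', MForm.or, MForm.neg, msat, iha, ihb]
      tauto
    | imp a b iha ihb =>
      intro s
      simp only [isat, gt', msat, iha, ihb]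
  · intro φ h
    induction h with
    | bot => exact .bot
    | var p => exact .var p
    | imp _ _ iha ihb => exact .boximp iha ihb
end

section
/- For m ≥ 2 even, let φ_G be the variable-free modal formula consisting of m−1 alternating modal operators ◇◻◇⋯◻◇, starting with ◇, applied to ◇⊤, and define the strictly implicational variable-free formulas ρ₁ := ◻(◻(⊥→⊥) → ◻(◻(⊥→⊥) → ⊥)) and ρ_{k+1} := ◻(ρ_k → ⊥). Then for every Kripke model M = (U, R, ξ) and every state w ∈ U: M, w ⊨ₘ ρ_{m−1} if and only if M, w ⊭ₘ φ_G; that is, ρ_{m−1} is equivalent to ¬φ_G over all Kripke models. -/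
/-- `phiChain (m-1)` is the formula `φ_G`: a sequence of `m−1` alternating modal
operators `◇◻◇⋯◻◇` (starting, for `m` even, with `◇` at the outside) applied to `◇⊤`. -/
def phiChain {α : Type} : ℕ → MForm α
  | 0 => MForm.dia MForm.top
  | k+1 => if Even k then MForm.dia (phiChain k) else MForm.box (phiChain k)

/-- `rhoChain k` is the formula `ρ_{k+1}`, where
`ρ₁ := ◻(◻(⊥→⊥) → ◻(◻(⊥→⊥) → ⊥))` and `ρ_{k+1} := ◻(ρ_k → ⊥)`. -/
def rhoChain {α : Type} : ℕ → MForm α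
  | 0 => .box (.imp (.box (.imp .bot .bot))
               (.box (.imp (.box (.imp .bot .bot)) .bot)))
  | k+1 => .box (.imp (rhoChain k) .bot)

theorem rho_aux {α U : Type} (R : U → U → Prop) (ξ : α → U → Prop) (k : ℕ) :
    ∀ w, (Even k → (msat R ξ w (rhoChain k) ↔ ¬ msat R ξ w (phiChain (k + 1)))) ∧
      (¬ Even k → (msat R ξ w (rhoChain k) ↔ msat R ξ w (phiChain (k + 1)))) := by
  induction k with
  | zero =>
    intro w
    simp [rhoChain, phiChain, msat, MForm.dia, MForm.neg, MForm.top]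
  | succ k ih =>
    intro w
    constructor
    · intro h
      have hk : ¬ Even k := by
        rw [Nat.even_add_one] at h
        exact h
      have e : (phiChain (k + 1 + 1) : MForm α) = MForm.dia (phiChain (k + 1)) := by
        rw [phiChain, if_pos h]
      rw [e]
      simp only [rhoChain, msat, MForm.dia, MForm.neg, (ih _).2 hk]
      tauto
    · intro h
      have hk : Even k := by
        rw [Nat.even_add_one] at h
        exact not_not.mp h
      have e : (phiChain (k + 1 + 1) : MForm α) = MForm.box (phiChain (k + 1)) := by
        rw [phiChain, if_neg h]
      rw [e]
      simp only [rhoChain, msat, (ih _).1 hk]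
      exact forall_congr' fun t => imp_congr_right fun _ => not_not

theorem rho_strict {α : Type} (k : ℕ) : (rhoChain k : MForm α).StrictImp := by
  induction k with
  | zero =>
    exact .boximp (.boximp .bot .bot) (.boximp (.boximp .bot .bot) .bot)
  | succ k ih => exact .boximp ih .bot

/-- For even `m ≥ 2`, the strictly implicational variable-free formula `ρ_{m−1}`
is equivalent to `¬φ_G` over all Kripke models. -/
theorem stmt5 {α : Type} (m : ℕ) (hm2 : 2 ≤ m) (hm : Even m)
    {U : Type} [Fintype U] [Nonempty U]
    (R : U → U → Prop) (ξ : α → U → Prop) (w : U) :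
    (msat R ξ w (rhoChain (m - 2)) ↔ ¬ msat R ξ w (phiChain (m - 1))) ∧
    (rhoChain (m - 2) : MForm α).StrictImp := by
  refine ⟨?_, rho_strict _⟩
  obtain ⟨k, rfl⟩ := Nat.exists_eq_add_of_le' hm2
  have hk : Even k := by
    rw [Nat.even_add] at hm
    exact hm.mpr even_two
  exact (rho_aux R ξ k w).1 hk
end

section
/- Let G = (V', E) be an alternating slice graph with m slices and t ∈ V_m, and let M_G = (V, ⩽, ξ) be the Kripke model obtained as follows: take the pseudo-transitive closure of G, add a new slice V_{m+1} := {top}, add an edge from every node of V' to top, and take the reflexive closure; set ξ(a_i) := V_{i+1} ∪ ⋯ ∪ V_{m+1} for i = 1, …, m−1, ξ(a_m) := {t, top}, ξ(a_{m+1}) := {top}. Define the implicational formulas ψ_m := a_m ⇒ a_{m+1} and ψ_j := ψ_{j+1} ⇒ a_j for j = m−1, …, 1. Then for all i = 1, …, m−1: (1) M_G, w ⊨ᵢ ψ_i for every w ∈ V_{≥i+1}; (2) for every w ∈ V_i, M_G, w ⊨ᵢ ψ_i if and only if M_G, w ⊭ᵢ ψ_{i+1}; (3) for every w ∈ V_i,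 M_G, w ⊨ᵢ ψ_i if and only if there exists u ∈ V_{i+1} with w ⩽ u, u ≠ w, and M_G, u ⊭ᵢ ψ_{i+1}. -/
/-- An alternating slice graph with `m` slices: `slice v` is the (1-based) index of the
slice containing `v`; existential nodes are those in odd slices, universal nodes those in
even slices; every edge goes from slice `i` to slice `i+1`; every node outside the last
slice has outdegree `> 0`. -/
structure SliceGraph (V : Type) (m : ℕ) where
  slice : V → ℕ
  E : V → V → Prop
  slice_pos : ∀ v, 1 ≤ slice v
  slice_le : ∀ v, slice v ≤ m
  edge_slice : ∀ ⦃u v⦄, E u v → slice v = slice u + 1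
  outdeg : ∀ v, slice v < m → ∃ u, E v u

/-- The edge relation of the pseudo-transitive closure of a slice graph:
the original edges together with all edges from `Vᵢ` to `V_{≥ i+2}`. -/
def ptcR {V : Type} {m : ℕ} (G : SliceGraph V m) : V → V → Prop :=
  fun u v => G.E u v ∨ G.slice u + 2 ≤ G.slice v

/-- The states of the KC model `M_G`: the nodes of the slice graph together with a
fresh top state (`none`). -/
abbrev KCState (V : Type) := Option V

/-- Slice index in the KC model: nodes keep their slice, `top` sits in slice `m+1`. -/
def kcSlice {V : Type} {m : ℕ} (G : SliceGraph V m) : KCState V → ℕ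
  | some v => G.slice v
  | none => m + 1

/-- The accessibility relation `⩽` of the KC model: the reflexive closure of the
pseudo-transitive closure of `G` together with an edge from every node to `top`. -/
def kcR {V : Type} {m : ℕ} (G : SliceGraph V m) : KCState V → KCState V → Prop :=
  fun x y => x = y ∨
    match x, y with
    | some a, some b => G.E a b ∨ G.slice a + 2 ≤ G.slice b
    | some _, none => True
    | none, _ => False

/-- The valuation of the KC model (variable `i` stands for `aᵢ`):
`ξ(aᵢ) = V_{i+1} ∪ ⋯ ∪ V_{m+1}` for `1 ≤ i ≤ m−1`, `ξ(a_m) = {t, top}`,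
`ξ(a_{m+1}) = {top}`. -/
def kcVal {V : Type} {m : ℕ} (G : SliceGraph V m) (t : V) : ℕ → KCState V → Prop :=
  fun i x =>
    (i + 1 ≤ m ∧ i + 1 ≤ kcSlice G x) ∨
    (i = m ∧ (x = some t ∨ x = none)) ∨
    (i = m + 1 ∧ x = none)

/-- `kcPsi m (m - j)` is the formula `ψ_j`, where `ψ_m := a_m ⇒ a_{m+1}` and
`ψ_j := ψ_{j+1} ⇒ a_j`. -/
def kcPsi (m : ℕ) : ℕ → IForm ℕ
  | 0 => .imp (.var m) (.var (m+1))
  | k+1 => .imp (kcPsi m k) (.var (m - (k+1)))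

theorem kcR_trans' {V : Type} {m : ℕ} (G : SliceGraph V m) {x y z : KCState V}
    (h1 : kcR G x y) (h2 : kcR G y z) : kcR G x z := by
  have e := G.edge_slice
  rcases h1 with rfl | h1
  · exact h2
  rcases h2 with rfl | h2
  · exact Or.inr h1
  rcases x with _ | a <;> rcases y with _ | b <;> rcases z with _ | c <;> simp_all [kcR]
  right; right
  rcases h1 with h1 | h1 <;> rcases h2 with h2 | h2
  · have := e h1; have := e h2; omega
  · have := e h1; omega
  · have := e h2; omega
  · omega

theorem kcR_slice' {V : Type} {m : ℕ} (G : SliceGraph V m) {x y : KCState V}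
    (h : kcR G x y) : x = y ∨ kcSlice G x + 1 ≤ kcSlice G y := by
  rcases h with rfl | h
  · exact Or.inl rfl
  right
  rcases x with _ | a <;> rcases y with _ | b <;> simp_all [kcSlice]
  · exact G.slice_le a
  · rcases h with h | h
    · have := G.edge_slice h; omega
    · omega

theorem kcPsi_mono' {V : Type} {m : ℕ} (G : SliceGraph V m) (t : V) (k : ℕ) {x y : KCState V}
    (h : kcR G x y) (hx : isat (kcR G) (kcVal G t) x (kcPsi m k)) :
    isat (kcR G) (kcVal G t) y (kcPsi m k) := by
  cases k <;> exact fun n hn => hx n (kcR_trans' G h hn)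

theorem kcVal_lt' {V : Type} {m : ℕ} (G : SliceGraph V m) (t : V) {i : ℕ} (hi : i + 1 ≤ m)
    (x : KCState V) : kcVal G t i x ↔ i + 1 ≤ kcSlice G x := by
  unfold kcVal
  constructor
  · rintro (h | h | h)
    · exact h.2
    · omega
    · omega
  · exact fun h => Or.inl ⟨hi, h⟩

theorem kcPsi_sat' {V : Type} {m : ℕ} (G : SliceGraph V m) (t : V) {i : ℕ} (hi : i + 1 ≤ m)
    (x : KCState V) : isat (kcR G) (kcVal G t) x (kcPsi m (m - i)) ↔
      ∀ n, kcR G x n → isat (kcR G) (kcVal G t) n (kcPsi m (m - (i+1))) →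
        i + 1 ≤ kcSlice G n := by
  obtain ⟨k, hk⟩ : ∃ k, m - i = k + 1 := ⟨m - i - 1, by omega⟩
  have h1 : m - (i+1) = k := by omega
  have h2 : m - (k+1) = i := by omega
  rw [hk, h1]
  simp only [kcPsi, isat, h2, kcVal_lt' G t hi]

/-- Properties of the formulas `ψᵢ` on the KC model `M_G` (for `1 ≤ i ≤ m−1`):
(1) `ψᵢ` is satisfied in every state of `V_{≥ i+1}`;
(2) in slice `Vᵢ`, `ψᵢ` is satisfied iff `ψ_{i+1}` is not;
(3) in slice `Vᵢ`, `ψᵢ` is satisfied at `w` iff some `u ∈ V_{i+1}` with `w ⩽ u`, `u ≠ w`,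
refutes `ψ_{i+1}`. -/
theorem stmt6 {V : Type} [Fintype V] {m : ℕ} (G : SliceGraph V m)
    (t : V) (ht : G.slice t = m) :
    ∀ i : ℕ, 1 ≤ i → i ≤ m - 1 →
      (∀ w : KCState V, i + 1 ≤ kcSlice G w →
          isat (kcR G) (kcVal G t) w (kcPsi m (m - i))) ∧
      (∀ v : V, G.slice v = i →
          (isat (kcR G) (kcVal G t) (some v) (kcPsi m (m - i)) ↔
            ¬ isat (kcR G) (kcVal G t) (some v) (kcPsi m (m - (i+1))))) ∧
      (∀ v : V, G.slice v = i →
          (isat (kcR G) (kcVal G t) (some v) (kcPsi m (m - i)) ↔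
            ∃ u : V, G.slice u = i + 1 ∧ kcR G (some v) (some u) ∧ u ≠ v ∧
              ¬ isat (kcR G) (kcVal G t) (some u) (kcPsi m (m - (i+1))))) := by
  intro i hi1 him
  have hi : i + 1 ≤ m := by omega
  have h2 : ∀ v : V, G.slice v = i →
          (isat (kcR G) (kcVal G t) (some v) (kcPsi m (m - i)) ↔
            ¬ isat (kcR G) (kcVal G t) (some v) (kcPsi m (m - (i+1)))) := by
    intro v hv
    rw [kcPsi_sat' G t hi]
    constructor
    · intro h h'
      have := h (some v) (Or.inl rfl) h'
      simp only [kcSlice] at this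
      omega
    · intro h n hn hs
      rcases kcR_slice' G hn with rfl | h'
      · exact absurd hs h
      · simp only [kcSlice, hv] at h'
        exact h'
  refine ⟨?_, h2, ?_⟩
  · intro w hw
    rw [kcPsi_sat' G t hi]
    intro n hn _
    rcases kcR_slice' G hn with rfl | h <;> omega
  · intro v hv
    rw [h2 v hv]
    constructor
    · intro h
      rcases Nat.lt_or_ge (i+1) m with hlt | hge
      · rw [kcPsi_sat' G t hlt] at h
        push Not at h
        obtain ⟨n, hn, hs, hsl⟩ := h
        have key : ∀ u : V, G.slice u = i + 1 → kcR G (some v) (some u) →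
            isat (kcR G) (kcVal G t) (some u) (kcPsi m (m - (i+1+1))) →
            ∃ u : V, G.slice u = i + 1 ∧ kcR G (some v) (some u) ∧ u ≠ v ∧
              ¬ isat (kcR G) (kcVal G t) (some u) (kcPsi m (m - (i+1))) := by
          intro u hu hvu hsu
          refine ⟨u, hu, hvu, ?_, ?_⟩
          · rintro rfl; omega
          · rw [kcPsi_sat' G t hlt]
            intro h
            have := h (some u) (Or.inl rfl) hsu
            simp only [kcSlice] at this
            omega
        rcases kcR_slice' G hn with rfl | h'
        · obtain ⟨u, hu⟩ := G.outdeg v (by omega)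
          have hvu : kcR G (some v) (some u) := Or.inr (Or.inl hu)
          exact key u (by rw [G.edge_slice hu, hv]) hvu (kcPsi_mono' G t _ hvu hs)
        · rcases n with _ | u
          · simp only [kcSlice] at hsl; omega
          · simp only [kcSlice] at hsl h'
            exact key u (by omega) hn hs
      · have hm : m = i + 1 := by omega
        have h0 : m - (i+1) = 0 := by omega
        rw [h0] at h ⊢
        simp only [kcPsi, isat] at h ⊢
        push Not at h
        obtain ⟨n, hn, hs, hsl⟩ := h
        have hnt : n = some t := by
          rcases hs with h | h | h
          · omega
          · rcases h.2 with h | h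
            · exact h
            · exact absurd (Or.inr (Or.inr ⟨rfl, h⟩)) hsl
          · omega
        subst hnt
        refine ⟨t, by omega, hn, ?_, fun h => hsl (h _ (Or.inl rfl) hs)⟩
        rintro rfl; omega
    · rintro ⟨u, _, hvu, _, hn⟩ h
      exact hn (kcPsi_mono' G t _ hvu h)
end

section
/- Let G = (V, E) be an alternating slice graph with m slices and t ∈ V_m, let ≺ be the edge relation of the pseudo-transitive closure of G, and let M := (V, ≺, ξ) with ξ(p) := {t} (a one-variable FPL model: ≺ is transitive and irreflexive). Define α_m := ⊥, α_i := ⊤ ⇒ α_{i+1} for i = m−1, …, 1, and ψ_m := p, ψ_i := ψ_{i+1} ⇒ α_{i+1} for i = m−1, …, 1. Then: (1) for all i with m ≥ i ≥ 2 and all w ∈ V, M, w ⊨ᵢ α_i if and only if w ∈ V_{≥i+1}; (2) for all i with m ≥ i ≥ 2 and all w ∈ V_{i−1}, M, w ⊭ᵢ ψ_{i−1} if and only if there exists v ∈ V_i with w ≺ v and M, v ⊨ᵢ ψ_i. -/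
/-- `fplAlpha (m - i)` is the formula `αᵢ`, where `α_m := ⊥` and `αᵢ := ⊤ ⇒ α_{i+1}`
(with `⊤ := ¬⊥ = ⊥ ⇒ ⊥`). -/
def fplAlpha : ℕ → IForm Unit
  | 0 => .bot
  | k+1 => .imp (.imp .bot .bot) (fplAlpha k)

/-- `fplPsi (m - i)` is the formula `ψᵢ`, where `ψ_m := p` and `ψᵢ := ψ_{i+1} ⇒ α_{i+1}`. -/
def fplPsi : ℕ → IForm Unit
  | 0 => .var ()
  | k+1 => .imp (fplPsi k) (fplAlpha k)

/-- The valuation of the one-variable FPL model: `ξ(p) = {t}`. -/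
def fplVal {V : Type} (t : V) : Unit → V → Prop := fun _ v => v = t

/-- Properties of the formulas `αᵢ` and `ψᵢ` on the one-variable FPL model
`M = (V, ≺, ξ)` (`≺` the pseudo-transitive closure of the slice graph `G`,
`ξ(p) = {t}`): for `2 ≤ i ≤ m`,
(1) `αᵢ` is satisfied at `w` iff `w ∈ V_{≥ i+1}`;
(2) for `w ∈ V_{i−1}`, `ψ_{i−1}` is refuted at `w` iff some `v ∈ Vᵢ` with `w ≺ v`
satisfies `ψᵢ`. -/
theorem stmt8 {V : Type} [Fintype V] {m : ℕ} (G : SliceGraph V m)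
    (t : V) (ht : G.slice t = m) :
    (∀ i : ℕ, 2 ≤ i → i ≤ m → ∀ w : V,
        (isat (ptcR G) (fplVal t) w (fplAlpha (m - i)) ↔ i + 1 ≤ G.slice w)) ∧
    (∀ i : ℕ, 2 ≤ i → i ≤ m → ∀ w : V, G.slice w = i - 1 →
        (¬ isat (ptcR G) (fplVal t) w (fplPsi (m - (i - 1))) ↔
          ∃ v : V, G.slice v = i ∧ ptcR G w v ∧
            isat (ptcR G) (fplVal t) v (fplPsi (m - i)))) := by
  have up : ∀ u v, ptcR G u v → G.slice u + 1 ≤ G.slice v := by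
    rintro u v (h | h)
    · exact (G.edge_slice h).ge
    · omega
  have A : ∀ k i : ℕ, i + k = m → ∀ w : V,
      (isat (ptcR G) (fplVal t) w (fplAlpha k) ↔ i + 1 ≤ G.slice w) := by
    intro k
    induction k with
    | zero =>
      intro i hi w
      have := G.slice_le w
      simp only [fplAlpha, isat, false_iff]
      omega
    | succ k ih =>
      intro i hi w
      simp only [fplAlpha, isat]
      constructor
      · intro h
        by_contra hc
        obtain ⟨u, hu⟩ := G.outdeg w (by omega)
        have h1 := (ih (i + 1) (by omega) u).1 (h u (Or.inl hu) (fun _ _ h => h))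
        have h2 := G.edge_slice hu
        omega
      · intro h n hn _
        have := up _ _ hn
        exact (ih (i + 1) (by omega) n).2 (by omega)
  refine ⟨fun i _ hi w => A _ i (by omega) w, fun i h2 hi w hw => ?_⟩
  have e : m - (i - 1) = (m - i) + 1 := by omega
  rw [e]
  simp only [fplPsi, isat]
  constructor
  · intro h
    push Not at h
    obtain ⟨v, hv, hp, ha⟩ := h
    rw [A (m - i) i (by omega)] at ha
    have := up _ _ hv
    exact ⟨v, by omega, hv, hp⟩
  · rintro ⟨v, hs, hv, hp⟩ h
    have := (A (m - i) i (by omega) v).1 (h v hv hp)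
    omega
end

section
/- Define the variable-free intuitionistic formulas α_i for i ∈ ℕ ∪ {ω} by α₀ := ⊥, α_ω := ⊤, and α_{i+1} := ⊤ ⇒ α_i for i ∈ ℕ. Then every variable-free intuitionistic formula φ is FPL₀-equivalent to exactly one α_i: there exists a unique i ∈ ℕ ∪ {ω} such that for every finite Kripke model M with transitive and irreflexive accessibility relation and every state w of M, M, w ⊨ᵢ φ if and only if M, w ⊨ᵢ α_i. -/
/-- `vfAlpha i` is the variable-free formula `αᵢ` (for `i ∈ ℕ`): `α₀ := ⊥` and
`α_{i+1} := ⊤ ⇒ αᵢ` (with `⊤ := ¬⊥ = ⊥ ⇒ ⊥`). -/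
def vfAlpha : ℕ → IForm Empty
  | 0 => .bot
  | n+1 => .imp (.imp .bot .bot) (vfAlpha n)

/-- `vfAlphaE i` is `αᵢ` for `i ∈ ℕ ∪ {ω}` (with `ω = ⊤ : ℕ∞` and `α_ω := ⊤`). -/
def vfAlphaE : ℕ∞ → IForm Empty :=
  WithTop.recTopCoe (IForm.imp .bot .bot) vfAlpha

/-- FPL₀-equivalence: two variable-free formulas are equivalent if they are satisfied
at exactly the same states of every finite Kripke model with transitive and
irreflexive accessibility relation. -/
def FEquiv (φ ψ : IForm Empty) : Prop :=
  ∀ (W : Type) [Fintype W] (R : W → W → Prop), Transitive R → Irreflexive R →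
    ∀ w : W, isat R (fun p _ => p.elim) w φ ↔ isat R (fun p _ => p.elim) w ψ

abbrev AS {W : Type} (R : W → W → Prop) (w : W) (i : ℕ∞) : Prop :=
  isat R (fun p _ => p.elim) w (vfAlphaE i)

theorem AS_top {W : Type} (R : W → W → Prop) (w : W) : AS R w ⊤ := by
  show ∀ n, R w n → False → False
  exact fun _ _ h => h

theorem AS_zero {W : Type} (R : W → W → Prop) (w : W) : ¬ AS R w ((0 : ℕ) : ℕ∞) := by
  show ¬ False
  exact id

theorem AS_succ {W : Type} (R : W → W → Prop) (w : W) (n : ℕ) :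
    AS R w ((n + 1 : ℕ) : ℕ∞) ↔ ∀ v, R w v → AS R v (n : ℕ∞) := by
  show (∀ v, R w v → (∀ u, R v u → False → False) → AS R v (n : ℕ∞)) ↔ _
  exact ⟨fun h v hv => h v hv (fun _ _ h => h), fun h v hv _ => h v hv⟩

theorem AS_step {W : Type} (R : W → W → Prop) (n : ℕ) :
    ∀ w, AS R w (n : ℕ∞) → AS R w ((n + 1 : ℕ) : ℕ∞) := by
  induction n with
  | zero => intro w h; exact absurd h (AS_zero R w)
  | succ n ih =>
    intro w h
    rw [AS_succ] at h ⊢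
    exact fun v hv => ih v (h v hv)

theorem AS_mono {W : Type} (R : W → W → Prop) (w : W) {i j : ℕ∞} (hij : i ≤ j)
    (h : AS R w i) : AS R w j := by
  induction j using WithTop.recTopCoe with
  | top => exact AS_top R w
  | coe m =>
    induction i using WithTop.recTopCoe with
    | top => exact absurd (top_le_iff.mp hij) (WithTop.coe_ne_top)
    | coe n =>
      have hnm : n ≤ m := WithTop.coe_le_coe.mp hij
      clear hij
      induction hnm with
      | refl => exact h
      | step _ ih => exact AS_step R _ w ih

theorem AS_gap {W : Type} [Fintype W] (R : W → W → Prop) (ht : Transitive R)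
    (hi : Irreflexive R) (w : W) (n : ℕ) (h : ¬ AS R w ((n + 1 : ℕ) : ℕ∞)) :
    ∃ v, R w v ∧ ¬ AS R v (n : ℕ∞) ∧ AS R v ((n + 1 : ℕ) : ℕ∞) := by
  have wf : WellFounded (fun a b => R b a) := by
    haveI : IsTrans W (fun a b => R b a) := ⟨fun a b c h1 h2 => ht h2 h1⟩
    haveI : Std.Irrefl (fun a b : W => R b a) := ⟨fun a => hi a⟩
    exact Finite.wellFounded_of_trans_of_irrefl _
  rw [AS_succ] at h
  push Not at h
  obtain ⟨v, ⟨hv1, hv2⟩, hmin⟩ := wf.has_min {v | R w v ∧ ¬ AS R v (n : ℕ∞)} h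
  refine ⟨v, hv1, hv2, (AS_succ R v n).2 fun u hu => ?_⟩
  by_contra hc
  exact hmin u ⟨ht hv1 hu, hc⟩ hu

theorem AS_exists (φ : IForm Empty) : ∃ i : ℕ∞, FEquiv φ (vfAlphaE i) := by
  induction φ with
  | bot => exact ⟨((0 : ℕ) : ℕ∞), fun W _ R _ _ w => Iff.rfl⟩
  | var p => exact p.elim
  | and φ ψ h1 h2 =>
    obtain ⟨i, h1⟩ := h1
    obtain ⟨j, h2⟩ := h2
    rcases le_total i j with h | h
    · refine ⟨i, fun W _ R ht hi w => ?_⟩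
      rw [isat, h1 W R ht hi w, h2 W R ht hi w]
      exact and_iff_left_of_imp (AS_mono R w h)
    · refine ⟨j, fun W _ R ht hi w => ?_⟩
      rw [isat, h1 W R ht hi w, h2 W R ht hi w]
      exact and_iff_right_of_imp (AS_mono R w h)
  | or φ ψ h1 h2 =>
    obtain ⟨i, h1⟩ := h1
    obtain ⟨j, h2⟩ := h2
    rcases le_total i j with h | h
    · refine ⟨j, fun W _ R ht hi w => ?_⟩
      rw [isat, h1 W R ht hi w, h2 W R ht hi w]
      exact or_iff_right_of_imp (AS_mono R w h)
    · refine ⟨i, fun W _ R ht hi w => ?_⟩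
      rw [isat, h1 W R ht hi w, h2 W R ht hi w]
      exact or_iff_left_of_imp (AS_mono R w h)
  | imp φ ψ h1 h2 =>
    obtain ⟨i, h1⟩ := h1
    obtain ⟨j, h2⟩ := h2
    rcases le_or_gt i j with h | h
    · refine ⟨⊤, fun W _ R ht hi w => iff_of_true ?_ (AS_top R w)⟩
      intro v _ hv
      rw [h1 W R ht hi v] at hv
      exact (h2 W R ht hi v).2 (AS_mono R v h hv)
    · obtain ⟨n, rfl⟩ := ENat.ne_top_iff_exists.mp h.ne_top
      refine ⟨((n + 1 : ℕ) : ℕ∞), fun W _ R ht hi w => ?_⟩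
      constructor
      · intro hw
        by_contra hc
        obtain ⟨v, hv1, hv2, hv3⟩ := AS_gap R ht hi w n hc
        have hle : ((n + 1 : ℕ) : ℕ∞) ≤ i := by
          push_cast
          exact Order.add_one_le_of_lt h
        exact hv2 ((h2 W R ht hi v).1 (hw v hv1 ((h1 W R ht hi v).2 (AS_mono R v hle hv3))))
      · intro hw v hv _
        exact (h2 W R ht hi v).2 ((AS_succ R w n).1 hw v hv)

theorem AS_fin (N n : ℕ) : ∀ w : Fin N, AS (fun a b : Fin N => b < a) w (n : ℕ∞) ↔ w.val < n := by
  induction n with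
  | zero => intro w; exact iff_of_false (AS_zero _ w) (by omega)
  | succ n ih =>
    intro w
    rw [AS_succ]
    constructor
    · intro h
      by_contra hc
      have := (ih ⟨n, by omega⟩).1 (h ⟨n, by omega⟩ (by rw [Fin.lt_def]; simp; omega))
      simp at this
    · intro h v hv
      rw [ih]
      rw [Fin.lt_def] at hv
      omega

theorem AS_sep {i j : ℕ∞} (h : i < j)
    (he : ∀ (W : Type) [Fintype W] (R : W → W → Prop), Transitive R → Irreflexive R →
    ∀ w : W, AS R w i ↔ AS R w j) : False := by
  obtain ⟨n, rfl⟩ := ENat.ne_top_iff_exists.mp h.ne_top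
  have hle : ((n + 1 : ℕ) : ℕ∞) ≤ j := by
    push_cast
    exact Order.add_one_le_of_lt h
  have h1 := he (Fin (n+1)) (fun a b => b < a) (fun a b c h1 h2 => lt_trans h2 h1)
    (fun a => lt_irrefl a) (Fin.last n)
  have h2 := h1.2 (AS_mono _ _ hle ((AS_fin _ _ _).2 (by simp)))
  rw [AS_fin] at h2
  simp at h2

/-- Every variable-free intuitionistic formula is FPL₀-equivalent to exactly one `αᵢ`,
`i ∈ ℕ ∪ {ω}`. -/
theorem stmt10 (φ : IForm Empty) : ∃! i : ℕ∞, FEquiv φ (vfAlphaE i) := by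
  obtain ⟨i, hi⟩ := AS_exists φ
  refine ⟨i, hi, fun j hj => ?_⟩
  rcases lt_trichotomy j i with h | h | h
  · exact (AS_sep h fun W _ R a b w => (hj W R a b w).symm.trans (hi W R a b w)).elim
  · exact h
  · exact (AS_sep h fun W _ R a b w => (hi W R a b w).symm.trans (hj W R a b w)).elim
end

section
/- Define the variable-free intuitionistic formulas α_i for i ∈ ℕ ∪ {ω} by α₀ := ⊥, α_ω := ⊤, and α_{i+1} := ⊤ ⇒ α_i. Then for all a, b ∈ ℕ ∪ {ω}: (1) α_a ∧ α_b is FPL₀-equivalent to α_{min{a,b}}; (2) α_a ∨ α_b is FPL₀-equivalent to α_{max{a,b}}; (3) α_a ⇒ α_b is FPL₀-equivalent to α_ω if a ≤ b, and FPL₀-equivalent to α_{b+1} if a > b (in which case b ∈ ℕ). -/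
theorem vf_succ {W : Type} (R : W → W → Prop) (ξ : Empty → W → Prop) (n : ℕ) (s : W) :
    isat R ξ s (vfAlpha (n+1)) ↔ ∀ t, R s t → isat R ξ t (vfAlpha n) := by
  simp [vfAlpha, isat]

theorem vf_top {W : Type} (R : W → W → Prop) (ξ : Empty → W → Prop) (s : W) :
    isat R ξ s (vfAlphaE ⊤) := by
  change isat R ξ s (IForm.imp .bot .bot)
  simp [isat]

theorem vf_step {W : Type} (R : W → W → Prop) (ξ : Empty → W → Prop) (n : ℕ) :
    ∀ s : W, isat R ξ s (vfAlpha n) → isat R ξ s (vfAlpha (n+1)) := by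
  induction n with
  | zero => intro s h; exact h.elim
  | succ n ih =>
    intro s h
    rw [vf_succ] at h ⊢
    exact fun t ht => ih t (h t ht)

theorem vf_mono {W : Type} (R : W → W → Prop) (ξ : Empty → W → Prop) {a b : ℕ∞} (hab : a ≤ b)
    (s : W) (h : isat R ξ s (vfAlphaE a)) : isat R ξ s (vfAlphaE b) := by
  induction b using WithTop.recTopCoe with
  | top => exact vf_top R ξ s
  | coe b =>
    induction a using WithTop.recTopCoe with
    | top => exact absurd hab (WithTop.not_top_le_coe b)
    | coe a =>
      have hab' : a ≤ b := WithTop.coe_le_coe.mp hab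
      change isat R ξ s (vfAlpha a) at h
      change isat R ξ s (vfAlpha b)
      induction hab' with
      | refl => exact h
      | step h1 ih => exact vf_step R ξ _ s (ih (WithTop.coe_le_coe.mpr h1))

theorem vf_imp {W : Type} [Fintype W] (R : W → W → Prop) (hT : Transitive R) (hI : Irreflexive R)
    (ξ : Empty → W → Prop) {a : ℕ∞} {n : ℕ} (hab : ((n+1 : ℕ) : ℕ∞) ≤ a) (s : W) :
    (∀ t, R s t → isat R ξ t (vfAlphaE a) → isat R ξ t (vfAlpha n)) →
      ∀ t, R s t → isat R ξ t (vfAlpha n) := by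
  have wf : WellFounded (fun x y => R y x) := by
    haveI : IsTrans W (fun x y => R y x) := ⟨fun _ _ _ h1 h2 => hT h2 h1⟩
    haveI : Std.Irrefl (fun x y => R y x) := ⟨fun x => hI x⟩
    exact Finite.wellFounded_of_trans_of_irrefl _
  induction s using wf.induction with
  | _ s ih =>
    intro h t ht
    apply h t ht
    apply vf_mono R ξ hab
    change isat R ξ t (vfAlpha (n+1))
    rw [vf_succ]
    exact ih t ht fun u hu => h u (hT ht hu)

/-- Computation rules for the `αᵢ` (`i ∈ ℕ ∪ {ω}`) up to FPL₀-equivalence: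
`α_a ∧ α_b ≡_F α_{min(a,b)}`, `α_a ∨ α_b ≡_F α_{max(a,b)}`,
`α_a ⇒ α_b ≡_F α_ω` if `a ≤ b`, and `α_a ⇒ α_b ≡_F α_{b+1}` if `a > b`
(in which case `b ∈ ℕ`). -/
theorem stmt11 (a b : ℕ∞) :
    FEquiv (.and (vfAlphaE a) (vfAlphaE b)) (vfAlphaE (min a b)) ∧
    FEquiv (.or (vfAlphaE a) (vfAlphaE b)) (vfAlphaE (max a b)) ∧
    (a ≤ b → FEquiv (.imp (vfAlphaE a) (vfAlphaE b)) (vfAlphaE ⊤)) ∧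
    (b < a → ∃ n : ℕ, b = (n : ℕ∞) ∧
        FEquiv (.imp (vfAlphaE a) (vfAlphaE b)) (vfAlphaE ((n + 1 : ℕ) : ℕ∞))) := by
  refine ⟨?_, ?_, ?_, ?_⟩
  · intro W _ R _ _ w
    constructor
    · rintro ⟨h1, h2⟩
      rcases min_choice a b with h | h <;> rw [h] <;> assumption
    · intro h
      exact ⟨vf_mono R _ (min_le_left a b) w h, vf_mono R _ (min_le_right a b) w h⟩
  · intro W _ R _ _ w
    constructor
    · rintro (h | h)
      · exact vf_mono R _ (le_max_left a b) w h
      · exact vf_mono R _ (le_max_right a b) w h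
    · intro h
      rcases max_choice a b with h' | h' <;> rw [h'] at h
      · exact Or.inl h
      · exact Or.inr h
  · intro hab W _ R _ _ w
    exact ⟨fun _ => vf_top R _ w, fun _ t _ h => vf_mono R _ hab t h⟩
  · intro hab
    obtain ⟨n, rfl⟩ := ENat.ne_top_iff_exists.mp (ne_top_of_lt hab)
    refine ⟨n, rfl, ?_⟩
    intro W _ R hT hI w
    have hab' : ((n+1 : ℕ) : ℕ∞) ≤ a := by
      push_cast
      exact Order.add_one_le_of_lt hab
    change _ ↔ isat R _ w (vfAlpha (n+1))
    rw [vf_succ]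
    exact ⟨fun h => vf_imp R hT hI _ hab' w h, fun h t ht _ => h t ht⟩
end

section
/- Let M = (W, R) be a finite Kripke frame with R transitive and irreflexive, and for w ∈ W let lp_M(w) be the length of the longest R-path starting in w (lp_M(w) = 0 if w has no R-successor, and otherwise lp_M(w) = 1 + max over R-successors v of lp_M(v)). With α₀ := ⊥, α_ω := ⊤ and α_{i+1} := ⊤ ⇒ α_i: for every i ∈ ℕ ∪ {ω} and every state w ∈ W, M, w ⊨ᵢ α_i if and only if lp_M(w) < i. -/
/-- `IsLP R lp` says that `lp w` is the length of the longest `R`-path starting in `w`: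
`lp w = 0` if `w` has no `R`-successor, and otherwise
`lp w = 1 + max` over the `R`-successors `v` of `lp v`. -/
def IsLP {W : Type} (R : W → W → Prop) (lp : W → ℕ) : Prop :=
  ∀ w : W,
    ((∀ v, ¬ R w v) ∧ lp w = 0) ∨
    ((∃ v, R w v ∧ lp w = lp v + 1) ∧ ∀ v, R w v → lp v + 1 ≤ lp w)

/-- On a finite transitive irreflexive Kripke frame, `αᵢ` is satisfied at `w` iff
the longest path starting at `w` is shorter than `i` (for every `i ∈ ℕ ∪ {ω}`). -/
theorem stmt12 {W : Type} [Fintype W] (R : W → W → Prop)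
    (htrans : Transitive R) (hirr : Irreflexive R)
    (lp : W → ℕ) (hlp : IsLP R lp) (i : ℕ∞) (w : W) :
    isat R (fun p _ => p.elim) w (vfAlphaE i) ↔ (lp w : ℕ∞) < i := by
  have key : ∀ (n : ℕ) (w : W),
      isat R (fun p _ => p.elim) w (vfAlpha n) ↔ lp w < n := by
    intro n
    induction n with
    | zero => intro w; simp [vfAlpha, isat]
    | succ n ih =>
      intro w
      have h1 : isat R (fun p _ => p.elim) w (vfAlpha (n+1)) ↔ ∀ v, R w v → lp v < n := by
        simp [vfAlpha, isat, ih]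
      rw [h1]
      rcases hlp w with ⟨h, h0⟩ | ⟨⟨v, hv, hvw⟩, hmax⟩
      · constructor
        · intro _; omega
        · intro _ v hv; exact absurd hv (h v)
      · constructor
        · intro H; have := H v hv; omega
        · intro H u hu; have := hmax u hu; omega
  induction i using WithTop.recTopCoe with
  | top =>
    constructor
    · intro _; exact ENat.coe_lt_top _
    · intro _ n _ h; exact h
  | coe n =>
    refine (key n w).trans ?_
    exact (Nat.cast_lt (α := ℕ∞)).symm
end

section
/- Let M = (W, R) be a finite Kripke frame with R transitive and irreflexive, let lp_M(w) be the length of the longest R-path starting in w, and let α_i be defined by α₀ := ⊥, α_{i+1} := ⊤ ⇒ α_i. Then for every w ∈ W and every n ∈ ℕ: lp_M(w) = n if and only if M, w ⊨ᵢ α_{n+1} and M, w ⊭ᵢ α_n. -/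
theorem vfAlpha_iff_lt {W : Type} (R : W → W → Prop) (lp : W → ℕ) (hlp : IsLP R lp) (n : ℕ) :
    ∀ w : W, isat R (fun p _ => p.elim) w (vfAlpha n) ↔ lp w < n := by
  induction n with
  | zero => intro w; simp [vfAlpha, isat]
  | succ n ih =>
    intro w
    have key : isat R (fun p _ => p.elim) w (vfAlpha (n + 1)) ↔ ∀ v, R w v → lp v < n := by
      simp only [vfAlpha, isat]
      constructor
      · intro h v hv
        exact (ih v).1 (h v hv (fun _ _ hf => hf))
      · intro h v hv _
        exact (ih v).2 (h v hv)
    rw [key]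
    rcases hlp w with ⟨h1, h2⟩ | ⟨⟨v, hv, he⟩, h2⟩
    · exact ⟨fun _ => by omega, fun _ v hv => absurd hv (h1 v)⟩
    · constructor
      · intro h
        have := h v hv
        omega
      · intro h u hu
        have := h2 u hu
        omega

/-- On a finite transitive irreflexive Kripke frame, `lp w = n` iff `α_{n+1}` is
satisfied and `α_n` is refuted at `w`. -/
theorem stmt13 {W : Type} [Fintype W] (R : W → W → Prop)
    (htrans : Transitive R) (hirr : Irreflexive R)
    (lp : W → ℕ) (hlp : IsLP R lp) (w : W) (n : ℕ) :
    lp w = n ↔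
      (isat R (fun p _ => p.elim) w (vfAlpha (n + 1)) ∧
        ¬ isat R (fun p _ => p.elim) w (vfAlpha n)) := by
  rw [vfAlpha_iff_lt R lp hlp, vfAlpha_iff_lt R lp hlp]
  omega
end

section
/- Let M = (W, R) be a finite Kripke frame with R transitive and irreflexive, and for w ∈ W let lp_M(w) be the length of the longest R-path starting in w. For n ∈ ℕ let L_n be the Kripke frame ({0, 1, …, n}, >), where > is the usual strict order. Then for every variable-free modal formula φ and every w ∈ W: M, w ⊨ₘ φ if and only if L_{lp_M(w)}, lp_M(w) ⊨ₘ φ. -/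
theorem aux_fin (n : ℕ) (φ : MForm Empty) : ∀ i : Fin n,
    msat (fun i j : Fin n => (j : ℕ) < (i : ℕ)) (fun p _ => p.elim) i φ ↔
      msat (fun i j : ℕ => j < i) (fun p _ => p.elim) (i : ℕ) φ := by
  induction φ with
  | bot => intro i; simp [msat]
  | var p => exact p.elim
  | imp a b iha ihb => intro i; simp only [msat, iha, ihb]
  | box a ih =>
    intro i
    simp only [msat, ih]
    exact ⟨fun h t ht => h ⟨t, ht.trans i.2⟩ ht, fun h t ht => h t ht⟩

theorem aux_surj {W : Type} (R : W → W → Prop) (htrans : Transitive R)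
    (lp : W → ℕ) (hlp : IsLP R lp) : ∀ (n : ℕ) (w : W), lp w = n → ∀ k < n,
    ∃ v, R w v ∧ lp v = k := by
  intro n
  induction n with
  | zero => intro w _ k hk; omega
  | succ n ih =>
    intro w hw k hk
    rcases hlp w with ⟨_, h⟩ | ⟨⟨v, hv, h⟩, _⟩
    · omega
    · by_cases hkn : k = n
      · exact ⟨v, hv, by omega⟩
      · obtain ⟨u, hu, hk'⟩ := ih v (by omega) k (by omega)
        exact ⟨u, htrans hv hu, hk'⟩

theorem aux_lp {W : Type} (R : W → W → Prop) (htrans : Transitive R)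
    (lp : W → ℕ) (hlp : IsLP R lp) (φ : MForm Empty) : ∀ w : W,
    msat R (fun p _ => p.elim) w φ ↔
      msat (fun i j : ℕ => j < i) (fun p _ => p.elim) (lp w) φ := by
  induction φ with
  | bot => intro i; simp [msat]
  | var p => exact p.elim
  | imp a b iha ihb => intro i; simp only [msat, iha, ihb]
  | box a ih =>
    intro w
    simp only [msat, ih]
    constructor
    · intro h t ht
      obtain ⟨v, hv, rfl⟩ := aux_surj R htrans lp hlp _ w rfl t ht
      exact h v hv
    · intro h v hv
      apply h
      rcases hlp w with ⟨h0, _⟩ | ⟨_, h1⟩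
      · exact absurd hv (h0 v)
      · exact h1 v hv

/-- Reduction of a PrL₀ model to a linear one: on a finite transitive irreflexive
Kripke frame `M = (W,R)`, a variable-free modal formula is satisfied at `w` iff it
is satisfied at the state `lp_M(w)` of the linear frame
`L_{lp_M(w)} = ({0,…,lp_M(w)}, >)`. -/
theorem stmt16 {W : Type} [Fintype W] (R : W → W → Prop)
    (htrans : Transitive R) (hirr : Irreflexive R)
    (lp : W → ℕ) (hlp : IsLP R lp)
    (φ : MForm Empty) (w : W) :
    msat R (fun p _ => p.elim) w φ ↔
      msat (fun i j : Fin (lp w + 1) => (j : ℕ) < (i : ℕ)) (fun p _ => p.elim)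
        (Fin.last (lp w)) φ := by
  rw [aux_lp R htrans lp hlp, aux_fin, Fin.val_last]
end

section
/- For every variable-free modal formula φ, exactly one of the following holds: either M, w ⊨ₘ φ for every Kripke model M whose frame is reflexive and transitive and every state w of M, or M, w ⊭ₘ φ for every such model M and state w. In other words, the satisfaction of a variable-free modal formula at a state of a reflexive transitive Kripke model does not depend on the model or the state. -/
theorem msat_const (φ : MForm Empty) : ∃ b : Prop, ∀ (U : Type) (R : U → U → Prop)
    (ξ : Empty → U → Prop), (∀ x, R x x) → ∀ w : U, (msat R ξ w φ ↔ b) := by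
  induction φ with
  | bot => exact ⟨False, fun _ _ _ _ _ => Iff.rfl⟩
  | var p => exact p.elim
  | imp φ ψ ih1 ih2 =>
    obtain ⟨a, ha⟩ := ih1
    obtain ⟨b, hb⟩ := ih2
    exact ⟨a → b, fun U R ξ h w => imp_congr (ha U R ξ h w) (hb U R ξ h w)⟩
  | box φ ih =>
    obtain ⟨a, ha⟩ := ih
    exact ⟨a, fun U R ξ h w => ⟨fun H => (ha U R ξ h w).1 (H w (h w)),
      fun H t _ => (ha U R ξ h t).2 H⟩⟩

/-- Every variable-free modal formula is either satisfied at every state of every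
reflexive transitive Kripke model, or refuted at every state of every such model —
exactly one of the two alternatives holds. -/
theorem stmt17 (φ : MForm Empty) :
    Xor'
      (∀ (U : Type) [Fintype U] [Nonempty U] (R : U → U → Prop)
          (ξ : Empty → U → Prop), Reflexive R → Transitive R →
          ∀ w : U, msat R ξ w φ)
      (∀ (U : Type) [Fintype U] [Nonempty U] (R : U → U → Prop)
          (ξ : Empty → U → Prop), Reflexive R → Transitive R →
          ∀ w : U, ¬ msat R ξ w φ) := by
  obtain ⟨b, hb⟩ := msat_const φ
  by_cases h : b
  · refine Or.inl ⟨fun U _ _ R ξ hr _ w => (hb U R ξ (fun x => hr x) w).2 h, fun H => ?_⟩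
    exact H Unit (fun _ _ => True) (fun _ _ => True) (fun _ => trivial)
      (fun _ _ _ _ _ => trivial) () ((hb _ _ _ (fun _ => trivial) _).2 h)
  · refine Or.inr ⟨fun U _ _ R ξ hr _ w hw => h ((hb U R ξ (fun x => hr x) w).1 hw), fun H => ?_⟩
    exact h ((hb _ _ _ (fun _ => trivial) _).1 (H Unit (fun _ _ => True) (fun _ _ => True)
      (fun _ => trivial) (fun _ _ _ _ _ => trivial) ()))
end
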